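/- There exist absolute constants p ∈ (0,1/4) and C > 0 such that the following holds. For every finite set V with |V| = n ≥ 2, every family of unit vectors (x_u)_{u∈V} in a real inner product space satisfying ‖x_u − x_v‖² + ‖x_v − x_w‖² ≥ ‖x_u − x_w‖² for all u,v,w ∈ V, and every β ∈ (0,1), there exists a random assignment ω : V → {0,1} (a probability distribution over functions V → {0,1}) such that: (i) for every u,v ∈ V with ‖x_u − x_v‖² ≥ β, Pr(ω(u) ≠ ω(v)) ≥ 2p; and (ii) for every set e ⊆ V with |e| ≥ 2, Pr(ω(u) ≠ ω(v) for some u,v ∈ e) ≤ C·β^{-1}·√(log₂ n)·max_{u,v∈e} ‖x_u − x_v‖². -/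

import Mathlib

open scoped Classical BigOperators RealInnerProductSpace

noncomputable section

/-- A hyperedge `e` is cut by a set `S` if `e ∩ S ≠ ∅` and `e \ S ≠ ∅`. -/
def Cuts {V : Type*} [DecidableEq V] (S e : Finset V) : Prop :=
  (e ∩ S).Nonempty ∧ (e \ S).Nonempty

/-- Number of hyperedges (indexed by `ι`) cut by `S`. -/
def cutCount {V ι : Type*} [DecidableEq V] [Fintype ι]
    (ed : ι → Finset V) (S : Finset V) : ℕ :=
  (Finset.univ.filter (fun i => Cuts S (ed i))).card

/-- `max_{u,v ∈ e} ‖x u - x v‖²`. -/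
def maxDistSq {V H : Type*} [NormedAddCommGroup H] (x : V → H) (e : Finset V) : ℝ :=
  sSup {d : ℝ | ∃ u ∈ e, ∃ v ∈ e, d = ‖x u - x v‖ ^ 2}

/-- `max_{u,v ∈ e} ‖x u - x v‖`. -/
def maxDist {V H : Type*} [NormedAddCommGroup H] (x : V → H) (e : Finset V) : ℝ :=
  sSup {d : ℝ | ∃ u ∈ e, ∃ v ∈ e, d = ‖x u - x v‖}

/-- `min_{w ∈ e} ‖x w‖`. -/
def minNorm {V H : Type*} [NormedAddCommGroup H] (x : V → H) (e : Finset V) : ℝ :=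
  sInf {d : ℝ | ∃ w ∈ e, d = ‖x w‖}

/-- SDP value of a vector solution. -/
def sdpValue {V ι H : Type*} [Fintype ι] [NormedAddCommGroup H]
    (ed : ι → Finset V) (x : V → H) : ℝ :=
  ∑ i : ι, maxDistSq x (ed i)

/-- Expansion of a set `S` in the hypergraph. -/
def expansion {V ι : Type*} [Fintype V] [DecidableEq V] [Fintype ι]
    (ed : ι → Finset V) (S : Finset V) : ℝ :=
  (cutCount ed S : ℝ) / min (S.card : ℝ) ((Sᶜ : Finset V).card : ℝ)

/-- Small set expansion `φ*_{H,δ}`. -/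
def phiStar {V ι : Type*} [Fintype V] [DecidableEq V] [Fintype ι]
    (ed : ι → Finset V) (δ : ℝ) : ℝ :=
  sInf {c : ℝ | ∃ S : Finset V, S.Nonempty ∧ (S.card : ℝ) ≤ δ * Fintype.card V ∧
                c = expansion ed S}

/-- Feasibility for the SDP relaxation of H-SSE with parameter `δ`. -/
def SDPFeasible {V H : Type*} [Fintype V] [NormedAddCommGroup H] [InnerProductSpace ℝ H]
    (x : V → H) (δ : ℝ) : Prop :=
  (∀ u : V, ∑ v : V, (⟪x u, x v⟫ : ℝ) ≤ δ * (Fintype.card V : ℝ) * ‖x u‖ ^ 2) ∧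
  (∑ u : V, ‖x u‖ ^ 2 = 1) ∧
  (∀ u v w : V, ‖x u - x w‖ ^ 2 ≤ ‖x u - x v‖ ^ 2 + ‖x v - x w‖ ^ 2) ∧
  (∀ u v : V, 0 ≤ (⟪x u, x v⟫ : ℝ) ∧ (⟪x u, x v⟫ : ℝ) ≤ ‖x u‖ ^ 2)

/-- The `ℓ2²`-triangle inequalities for a family of vectors. -/
def L22 {V H : Type*} [NormedAddCommGroup H] [InnerProductSpace ℝ H] (x : V → H) : Prop :=
  (∀ u v w : V, ‖x u - x w‖ ^ 2 ≤ ‖x u - x v‖ ^ 2 + ‖x v - x w‖ ^ 2) ∧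
  (∀ u v : V, 0 ≤ (⟪x u, x v⟫ : ℝ) ∧ (⟪x u, x v⟫ : ℝ) ≤ ‖x u‖ ^ 2)

/-- Probability of an event under a finitely supported distribution. -/
def Pr {Ω : Type*} [Fintype Ω] (μ : Ω → ℝ) (P : Ω → Prop) : ℝ :=
  ∑ ω : Ω, if P ω then μ ω else 0

/-- A finitely supported probability distribution. -/
def IsProbDist {Ω : Type*} [Fintype Ω] (μ : Ω → ℝ) : Prop :=
  (∀ ω, 0 ≤ μ ω) ∧ ∑ ω : Ω, μ ω = 1

/-- `η(u)` for a choice `c` of subsets `e° ⊆ e`. -/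
def eta {V ι : Type*} [Fintype ι] (ed c : ι → Finset V) (u : V) : ℝ :=
  ∑ i : ι, if u ∈ c i then Real.logb 2 ((ed i).card) / ((c i).card : ℝ) else 0

/-- `η̂(H)`: the minimum over all valid choices `(e°)_{e∈E}` of `max_{u∈V} η(u)`. -/
def etaHat {V ι : Type*} [Fintype V] [Fintype ι] (ed : ι → Finset V) : ℝ :=
  sInf {b : ℝ | ∃ c : ι → Finset V, (∀ i, c i ⊆ ed i ∧ (c i).Nonempty) ∧
                b = ⨆ u : V, eta ed c u}

/-- The Rademacher sum `∑ i, ± a i` with signs given by `ε`. -/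
def rademacherSum {N : ℕ} (a : Fin N → ℝ) (ε : Fin N → Bool) : ℝ :=
  ∑ i, a i * (if ε i then 1 else -1)

lemma expect_fin_succ_bool {N : ℕ} (F : (Fin (N + 1) → Bool) → ℝ) :
    𝔼 ε, F ε = (𝔼 ε, F (Fin.cons true ε) + 𝔼 ε, F (Fin.cons false ε)) / 2 := by
  have h : ∑ ε, F ε = ∑ ε, F (Fin.cons true ε) + ∑ ε, F (Fin.cons false ε) := by
    rw [← (Fin.consEquiv fun _ => Bool).sum_comp, Fintype.sum_prod_type]
    simp [Fin.consEquiv]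
  simp only [Fintype.expect_eq_sum_div_card, h]
  simp only [Fintype.card_pi, Fintype.card_bool, Finset.prod_const, Finset.card_univ,
    Fintype.card_fin, pow_succ]
  push_cast
  field_simp

lemma rademacherSum_cons {N : ℕ} (a : Fin (N + 1) → ℝ) (b : Bool) (ε : Fin N → Bool) :
    rademacherSum a (Fin.cons b ε) =
      a 0 * (if b then 1 else -1) + rademacherSum (fun i => a i.succ) ε := by
  simp [rademacherSum, Fin.sum_univ_succ]

lemma rademacherSum_not {N : ℕ} (a : Fin N → ℝ) (ε : Fin N → Bool) :
    rademacherSum a (fun i => !ε i) = -rademacherSum a ε := by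
  simp only [rademacherSum, ← Finset.sum_neg_distrib]
  refine Finset.sum_congr rfl fun i _ => ?_
  by_cases h : ε i = true <;> simp [h]

lemma rademacherSum_sub {N : ℕ} (a b : Fin N → ℝ) (ε : Fin N → Bool) :
    rademacherSum (a - b) ε = rademacherSum a ε - rademacherSum b ε := by
  simp only [rademacherSum, ← Finset.sum_sub_distrib, Pi.sub_apply, sub_mul]

lemma rademacherSum_smul {N : ℕ} (c : ℝ) (a : Fin N → ℝ) (ε : Fin N → Bool) :
    rademacherSum (c • a) ε = c * rademacherSum a ε := by
  simp only [rademacherSum, Finset.mul_sum, Pi.smul_apply, smul_eq_mul, mul_assoc]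

lemma rademacherSum_update_not {N : ℕ} (a : Fin N → ℝ) (ε : Fin N → Bool) (i : Fin N) :
    rademacherSum a ε - rademacherSum a (Function.update ε i (!ε i)) =
      2 * (a i * (if ε i then 1 else -1)) := by
  simp only [rademacherSum, ← Finset.sum_sub_distrib]
  rw [Finset.sum_eq_single i]
  · rcases ε i <;> simp <;> ring
  · intro j _ hj
    simp [Function.update_of_ne hj]
  · simp

lemma expect_bool_not {N : ℕ} (F : (Fin N → Bool) → ℝ) :
    𝔼 ε : Fin N → Bool, F (fun i => !ε i) = 𝔼 ε, F ε :=
  Fintype.expect_bijective (fun (ε : Fin N → Bool) i => !ε i)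
    (Function.Involutive.bijective fun ε => by simp) _ _ fun _ => rfl

lemma expect_bool_update_not {N : ℕ} (F : (Fin N → Bool) → ℝ) (i : Fin N) :
    𝔼 ε : Fin N → Bool, F (Function.update ε i (!ε i)) = 𝔼 ε, F ε :=
  Fintype.expect_bijective (fun (ε : Fin N → Bool) => Function.update ε i (!ε i))
    (Function.Involutive.bijective fun ε => by simp) _ _ fun _ => rfl

/-- Hoeffding's bound for the moment generating function of a Rademacher sum. -/
lemma expect_exp_rademacherSum_le {N : ℕ} (a : Fin N → ℝ) :
    𝔼 ε, Real.exp (rademacherSum a ε) ≤ Real.exp ((∑ i, a i ^ 2) / 2) := by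
  induction N with
  | zero => simp [rademacherSum]
  | succ N ih =>
    have h := ih fun i => a i.succ
    rw [expect_fin_succ_bool, Fin.sum_univ_succ, add_div (a 0 ^ 2), Real.exp_add]
    simp only [rademacherSum_cons, Real.exp_add, ← Finset.mul_expect]
    have hc := Real.cosh_le_exp_half_sq (a 0)
    rw [Real.cosh_eq] at hc
    have h0 : 0 ≤ 𝔼 ε, Real.exp (rademacherSum (fun i => a i.succ) ε) :=
      Finset.expect_nonneg fun _ _ => (Real.exp_pos _).le
    calc _ = (Real.exp (a 0) + Real.exp (-a 0)) / 2 *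
          𝔼 ε, Real.exp (rademacherSum (fun i => a i.succ) ε) := by
          simp only [if_true, Bool.false_eq_true, if_false, mul_one, mul_neg]; ring
      _ ≤ _ := mul_le_mul hc h h0 (Real.exp_pos _).le

lemma expect_rademacherSum_sq {N : ℕ} (a : Fin N → ℝ) :
    𝔼 ε, rademacherSum a ε ^ 2 = ∑ i, a i ^ 2 := by
  induction N with
  | zero => simp [rademacherSum]
  | succ N ih =>
    have h := ih fun i => a i.succ
    rw [expect_fin_succ_bool, Fin.sum_univ_succ, ← h, ← Finset.expect_add_distrib]
    simp only [rademacherSum_cons]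
    calc _ = (𝔼 ε, 2 * (a 0 ^ 2 + rademacherSum (fun i => a i.succ) ε ^ 2)) / 2 := by
          congr 1
          refine Finset.expect_congr rfl fun ε _ => ?_
          simp only [if_true, Bool.false_eq_true, if_false]; ring
      _ = _ := by
          rw [← Finset.mul_expect, Finset.expect_add_distrib, Fintype.expect_const]; ring

lemma sq_expect_le_expect_sq {Ω : Type*} [Fintype Ω] [Nonempty Ω] (F : Ω → ℝ) :
    (𝔼 ω, F ω) ^ 2 ≤ 𝔼 ω, F ω ^ 2 := by
  have h : 0 ≤ 𝔼 ω, (F ω - 𝔼 ω, F ω) ^ 2 := Finset.expect_nonneg fun _ _ => sq_nonneg _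
  have h2 : 𝔼 ω, (F ω - 𝔼 ω, F ω) ^ 2 = 𝔼 ω, F ω ^ 2 - (𝔼 ω, F ω) ^ 2 := by
    set c := 𝔼 ω, F ω with hc
    calc 𝔼 ω, (F ω - c) ^ 2 = 𝔼 ω, (F ω ^ 2 - 2 * c * F ω + c ^ 2) :=
          Finset.expect_congr rfl fun _ _ => by ring
      _ = _ := by
          rw [Finset.expect_add_distrib, Finset.expect_sub_distrib, ← Finset.mul_expect,
            Fintype.expect_const, ← hc]; ring
  linarith

/-- The Efron–Stein inequality on the discrete cube. -/
lemma efron_stein_bool {N : ℕ} (F : (Fin N → Bool) → ℝ) :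
    𝔼 ε, F ε ^ 2 - (𝔼 ε, F ε) ^ 2 ≤
      (∑ i, 𝔼 ε, (F ε - F (Function.update ε i (!ε i))) ^ 2) / 4 := by
  induction N with
  | zero => simp
  | succ N ih =>
    have ht := ih fun ε => F (Fin.cons true ε)
    have hf := ih fun ε => F (Fin.cons false ε)
    have hd := sq_expect_le_expect_sq fun ε : Fin N → Bool =>
      F (Fin.cons true ε) - F (Fin.cons false ε)
    rw [Finset.expect_sub_distrib] at hd
    have h0 : 𝔼 ε : Fin N → Bool, (F (Fin.cons false ε) - F (Fin.cons true ε)) ^ 2 =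
        𝔼 ε : Fin N → Bool, (F (Fin.cons true ε) - F (Fin.cons false ε)) ^ 2 :=
      Finset.expect_congr rfl fun _ _ => by ring
    rw [Fin.sum_univ_succ]
    simp only [expect_fin_succ_bool, Fin.cons_zero, Fin.update_cons_zero, Fin.cons_succ,
      ← Fin.cons_update, Bool.not_true, Bool.not_false, h0]
    rw [← Finset.sum_div, Finset.sum_add_distrib]
    nlinarith

/-- Suprema of Rademacher sums have variance at most twice the largest variance. -/
lemma expect_abs_sub_sup'_rademacherSum_sq_le {N : ℕ} {V : Type*} {S : Finset V}
    (hS : S.Nonempty) (a : V → Fin N → ℝ) {L : ℝ} (hL : ∀ j ∈ S, ∑ i, a j i ^ 2 ≤ L) :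
    (𝔼 ε, |S.sup' hS (fun j => rademacherSum (a j) ε) -
      𝔼 ε', S.sup' hS (fun j => rademacherSum (a j) ε')|) ^ 2 ≤ 2 * L := by
  set F : (Fin N → Bool) → ℝ := fun ε => S.sup' hS (fun j => rademacherSum (a j) ε) with hF
  set c := 𝔼 ε, F ε with hc
  have hvar : 𝔼 ε, |F ε - c| ^ 2 = 𝔼 ε, F ε ^ 2 - c ^ 2 := by
    calc 𝔼 ε, |F ε - c| ^ 2 = 𝔼 ε, (F ε ^ 2 - 2 * c * F ε + c ^ 2) :=
          Finset.expect_congr rfl fun _ _ => by rw [sq_abs]; ring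
      _ = _ := by
          rw [Finset.expect_add_distrib, Finset.expect_sub_distrib, ← Finset.mul_expect,
            Fintype.expect_const, ← hc]; ring
  have hpos (i : Fin N) : 𝔼 ε, (F ε - F (Function.update ε i (!ε i))) ^ 2 =
      2 * 𝔼 ε, (max (F ε - F (Function.update ε i (!ε i))) 0) ^ 2 := by
    have h1 : 𝔼 ε, (max (F ε - F (Function.update ε i (!ε i))) 0) ^ 2 =
        𝔼 ε, (max (F (Function.update ε i (!ε i)) - F ε) 0) ^ 2 := by
      rw [← expect_bool_update_not _ i]
      refine Finset.expect_congr rfl fun ε _ => ?_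
      simp
    rw [two_mul]
    nth_rewrite 2 [h1]
    rw [← Finset.expect_add_distrib]
    refine Finset.expect_congr rfl fun ε _ => ?_
    rcases le_total (F ε) (F (Function.update ε i (!ε i))) with h | h
    · rw [max_eq_right (by linarith), max_eq_left (by linarith)]; ring
    · rw [max_eq_left (by linarith), max_eq_right (by linarith)]; ring
  have hpt (ε : Fin N → Bool) :
      ∑ i, (max (F ε - F (Function.update ε i (!ε i))) 0) ^ 2 ≤ 4 * L := by
    obtain ⟨j, hj, hjm⟩ := Finset.exists_mem_eq_sup' hS fun j => rademacherSum (a j) ε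
    calc _ ≤ ∑ i, 4 * a j i ^ 2 := by
          refine Finset.sum_le_sum fun i _ => ?_
          have h1 : rademacherSum (a j) (Function.update ε i (!ε i)) ≤
              F (Function.update ε i (!ε i)) :=
            Finset.le_sup' (fun j => rademacherSum (a j) (Function.update ε i (!ε i))) hj
          have h2 := rademacherSum_update_not (a j) ε i
          have h3 : a j i * (if ε i then 1 else -1) ≤ |a j i| := by
            split_ifs
            · simpa using le_abs_self _
            · simpa using neg_le_abs _
          have h4 : max (F ε - F (Function.update ε i (!ε i))) 0 ≤ 2 * |a j i| := by
            refine max_le ?_ (by positivity)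
            have : F ε = rademacherSum (a j) ε := hjm
            linarith
          calc _ ≤ (2 * |a j i|) ^ 2 := pow_le_pow_left₀ (le_max_right _ _) h4 2
            _ = _ := by rw [mul_pow, sq_abs]; ring
      _ ≤ _ := by rw [← Finset.mul_sum]; linarith [hL j hj]
  have hES := efron_stein_bool F
  have hsum : ∑ i, 𝔼 ε, (F ε - F (Function.update ε i (!ε i))) ^ 2 ≤ 2 * (4 * L) := by
    simp only [hpos, ← Finset.mul_sum, ← Finset.expect_sum_comm]
    gcongr
    exact Finset.expect_le Finset.univ_nonempty fun ε _ => hpt ε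
  have := sq_expect_le_expect_sq fun ε => |F ε - c|
  linarith

/-- The maximal inequality for at most `n` Rademacher sums. -/
lemma expect_sup'_rademacherSum_le {N : ℕ} {V : Type*} {S : Finset V}
    (hS : S.Nonempty) (a : V → Fin N → ℝ) {L n : ℝ} (hL0 : 0 < L) (hn : 1 < n)
    (hL : ∀ j ∈ S, ∑ i, a j i ^ 2 ≤ L) (hc : (S.card : ℝ) ≤ n) :
    𝔼 ε, S.sup' hS (fun j => rademacherSum (a j) ε) ≤ √(2 * L * Real.log n) := by
  set m := 𝔼 ε, S.sup' hS (fun j => rademacherSum (a j) ε) with hm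
  have hlog : 0 < Real.log n := Real.log_pos hn
  have key (l : ℝ) (hl : 0 < l) : l * m ≤ Real.log n + l ^ 2 * L / 2 := by
    have h1 : Real.exp (l * m) ≤ n * Real.exp (l ^ 2 * L / 2) := by
      have hlin (t : ℝ) : Real.exp (l * m) * (1 + (l * t - l * m)) ≤ Real.exp (l * t) := by
        have := Real.add_one_le_exp (l * t - l * m)
        calc _ ≤ Real.exp (l * m) * Real.exp (l * t - l * m) := by
              gcongr; linarith
          _ = _ := by rw [← Real.exp_add]; congr 1; ring
      calc Real.exp (l * m)
          = 𝔼 ε, Real.exp (l * m) *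
              (1 + (l * S.sup' hS (fun j => rademacherSum (a j) ε) - l * m)) := by
            rw [← Finset.mul_expect, Finset.expect_add_distrib, Finset.expect_sub_distrib,
              ← Finset.mul_expect, ← hm, Fintype.expect_const, Fintype.expect_const]
            ring
        _ ≤ 𝔼 ε, ∑ j ∈ S, Real.exp (rademacherSum (l • a j) ε) := by
            refine Finset.expect_le_expect fun ε _ => (hlin _).trans ?_
            obtain ⟨j, hj, hjm⟩ := Finset.exists_mem_eq_sup' hS fun j => rademacherSum (a j) ε
            rw [hjm, ← rademacherSum_smul]
            exact Finset.single_le_sum (f := fun j => Real.exp (rademacherSum (l • a j) ε))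
              (fun _ _ => (Real.exp_pos _).le) hj
        _ = ∑ j ∈ S, 𝔼 ε, Real.exp (rademacherSum (l • a j) ε) := Finset.expect_sum_comm _ _ _
        _ ≤ ∑ j ∈ S, Real.exp (l ^ 2 * L / 2) := by
            refine Finset.sum_le_sum fun j hj => (expect_exp_rademacherSum_le _).trans ?_
            simp only [Pi.smul_apply, smul_eq_mul, mul_pow, ← Finset.mul_sum]
            have := hL j hj
            gcongr
        _ ≤ _ := by
            rw [Finset.sum_const, nsmul_eq_mul]
            gcongr
    have h2 := Real.log_le_log (Real.exp_pos _) h1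
    rwa [Real.log_exp, Real.log_mul (by linarith) (Real.exp_pos _).ne', Real.log_exp] at h2
  have hs : 0 < √(2 * L * Real.log n) := Real.sqrt_pos.2 (by positivity)
  have hsq : √(2 * L * Real.log n) ^ 2 = 2 * L * Real.log n := Real.sq_sqrt (by positivity)
  set s := √(2 * L * Real.log n)
  have h := key (s / L) (by positivity)
  have e : Real.log n = s ^ 2 / (2 * L) := by rw [hsq]; field_simp
  rw [e] at h
  have h' : s / L * m ≤ s / L * s := by
    refine h.trans (le_of_eq ?_)
    field_simp
    ring
  exact le_of_mul_le_mul_left h' (by positivity)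

/-- Von Neumann's minimax theorem for finite games: if every mixed strategy of the row player is
answered by a column with payoff at least `c`, then some mixed strategy of the column player has
payoff at least `c` against every row. -/
lemma exists_mixed_strategy {P Z : Type*} [Fintype P] [Fintype Z] [Nonempty Z]
    (M : P → Z → ℝ) (c : ℝ)
    (h : ∀ w : P → ℝ, (∀ i, 0 ≤ w i) → ∑ i, w i = 1 → ∃ z, c ≤ ∑ i, w i * M i z) :
    ∃ q : Z → ℝ, (∀ z, 0 ≤ q z) ∧ ∑ z, q z = 1 ∧ ∀ i, c ≤ ∑ z, q z * M i z := by
  let T : (Z → ℝ) →ₗ[ℝ] (P → ℝ) := (Matrix.of M).mulVecLin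
  have hT (q : Z → ℝ) (i : P) : T q i = ∑ z, q z * M i z := by
    simp [T, Matrix.mulVec, dotProduct, mul_comm]
  have hTc : Continuous T := T.continuous_of_finiteDimensional
  by_contra! hcon
  have hdisj : Disjoint (T '' stdSimplex ℝ Z) {x : P → ℝ | ∀ i, c ≤ x i} := by
    rw [Set.disjoint_left]
    rintro _ ⟨q, hq, rfl⟩ hx
    obtain ⟨i, hi⟩ := hcon q hq.1 hq.2
    have := hx i
    rw [hT] at this
    linarith
  have hconv : Convex ℝ {x : P → ℝ | ∀ i, c ≤ x i} := by
    have : {x : P → ℝ | ∀ i, c ≤ x i} = Set.Ici fun _ => c := rfl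
    rw [this]
    exact convex_Ici _
  have hclosed : IsClosed {x : P → ℝ | ∀ i, c ≤ x i} := by
    have : {x : P → ℝ | ∀ i, c ≤ x i} = Set.Ici fun _ => c := rfl
    rw [this]
    exact isClosed_Ici
  obtain ⟨f, u, v, hfu, huv, hfv⟩ := geometric_hahn_banach_compact_closed
    ((convex_stdSimplex ℝ Z).linear_image T) ((isCompact_stdSimplex ℝ Z).image hTc)
    hconv hclosed hdisj
  set w : P → ℝ := fun i => f (Pi.single i 1) with hw
  have hf (x : P → ℝ) : f x = ∑ i, w i * x i := by
    conv_lhs => rw [pi_eq_sum_univ' x]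
    simp only [map_sum, map_smul, smul_eq_mul, hw]
    refine Finset.sum_congr rfl fun i _ => ?_
    rw [mul_comm]
  have hw0 (i : P) : 0 ≤ w i := by
    by_contra! hi
    have hc := hfv (fun _ => c) fun _ => le_rfl
    have h2 := hfv ((fun _ => c) + ((v - f fun _ => c) / w i) • Pi.single i 1) fun j => by
      have : 0 ≤ ((v - f fun _ => c) / w i) * (Pi.single i 1 : P → ℝ) j := by
        refine mul_nonneg (div_nonneg_of_nonpos (by linarith) hi.le) ?_
        by_cases hj : j = i
        · subst hj; simp
        · simp [Pi.single_eq_of_ne hj]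
      simpa using this
    rw [map_add, map_smul, smul_eq_mul] at h2
    change v < _ + _ / w i * w i at h2
    rw [div_mul_cancel₀ _ hi.ne] at h2
    linarith
  have hcol (z : Z) : ∑ i, w i * M i z < u := by
    have := hfu (T (Pi.single z 1)) ⟨_, single_mem_stdSimplex ℝ z, rfl⟩
    rw [hf] at this
    simpa [hT, Pi.single_apply] using this
  have hconst := hfv (fun _ => c) fun _ => le_rfl
  rw [hf, ← Finset.sum_mul] at hconst
  have hW0 : 0 ≤ ∑ i, w i := Finset.sum_nonneg fun i _ => hw0 i
  rcases hW0.eq_or_lt with hW | hW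
  · obtain ⟨z⟩ := ‹Nonempty Z›
    have hz (i : P) : w i = 0 :=
      (Finset.sum_eq_zero_iff_of_nonneg fun i _ => hw0 i).1 hW.symm i (Finset.mem_univ i)
    have := hcol z
    simp only [hz, zero_mul, Finset.sum_const_zero] at this hconst
    linarith
  · obtain ⟨z, hz⟩ := h (fun i => w i / ∑ i, w i) (fun i => div_nonneg (hw0 i) hW0) (by
      rw [← Finset.sum_div, div_self hW.ne'])
    have h3 := hcol z
    have h4 : ∑ i, w i / (∑ i, w i) * M i z = (∑ i, w i * M i z) / ∑ i, w i := by
      rw [Finset.sum_div]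
      exact Finset.sum_congr rfl fun _ _ => by ring
    rw [h4, le_div_iff₀ hW] at hz
    linarith

/-- A relation on a finite weighted set has a maximal fractional matching. -/
lemma exists_maximal_fractional_matching {V : Type*} [Fintype V] (E : V → V → Prop)
    (μ : V → ℝ) (hμ : ∀ u, 0 ≤ μ u) :
    ∃ m : V → V → ℝ, (∀ u v, 0 ≤ m u v) ∧ (∀ u v, m u v ≠ 0 → E u v) ∧
      (∀ u, ∑ v, m u v ≤ μ u) ∧ (∀ v, ∑ u, m u v ≤ μ v) ∧
      ∀ u v, E u v → ∑ v', m u v' = μ u ∨ ∑ u', m u' v = μ v := by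
  let K : Set (V → V → ℝ) := {m | (∀ u v, 0 ≤ m u v) ∧ (∀ u v, ¬E u v → m u v = 0) ∧
      (∀ u, ∑ v, m u v ≤ μ u) ∧ (∀ v, ∑ u, m u v ≤ μ v)}
  have hKc : IsClosed K := by
    simp only [K, Set.ofPred_and, Set.ofPred_forall]
    refine .inter ?_ (.inter ?_ (.inter ?_ ?_))
    · exact isClosed_iInter fun u => isClosed_iInter fun v =>
        isClosed_le (by fun_prop) (by fun_prop)
    · exact isClosed_iInter fun u => isClosed_iInter fun v => isClosed_iInter fun _ =>
        isClosed_eq (by fun_prop) (by fun_prop)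
    · exact isClosed_iInter fun u => isClosed_le (by fun_prop) (by fun_prop)
    · exact isClosed_iInter fun u => isClosed_le (by fun_prop) (by fun_prop)
  have hKb : K ⊆ Set.Icc 0 fun u _ => μ u := fun m hm =>
    ⟨hm.1, fun u v => (Finset.single_le_sum (fun v _ => hm.1 u v) (Finset.mem_univ v)).trans
      (hm.2.2.1 u)⟩
  have hK : IsCompact K := isCompact_Icc.of_isClosed_subset hKc hKb
  have hK0 : (0 : V → V → ℝ) ∈ K := by simp [K, hμ]
  obtain ⟨m, hm, hmax⟩ := hK.exists_isMaxOn ⟨0, hK0⟩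
    (f := fun m : V → V → ℝ => ∑ u, ∑ v, m u v) (by fun_prop)
  refine ⟨m, hm.1, fun u v => not_imp_comm.1 (hm.2.1 u v), hm.2.2.1, hm.2.2.2, fun u v huv => ?_⟩
  by_contra! hne
  have h1 := lt_of_le_of_ne (hm.2.2.1 u) hne.1
  have h2 := lt_of_le_of_ne (hm.2.2.2 v) hne.2
  obtain ⟨η, hη, hη1, hη2⟩ : ∃ η > 0, ∑ v', m u v' + η ≤ μ u ∧ ∑ u', m u' v + η ≤ μ v :=
    ⟨min (μ u - ∑ v', m u v') (μ v - ∑ u', m u' v), lt_min (by linarith) (by linarith),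
      by linarith [min_le_left (μ u - ∑ v', m u v') (μ v - ∑ u', m u' v)],
      by linarith [min_le_right (μ u - ∑ v', m u v') (μ v - ∑ u', m u' v)]⟩
  let b : V → V → ℝ := fun a c => if a = u then if c = v then η else 0 else 0
  have hrow (a : V) : ∑ c, b a c = if a = u then η else 0 := by
    by_cases h : a = u <;> simp [b, h]
  have hcol (c : V) : ∑ a, b a c = if c = v then η else 0 := by simp [b]
  have hmem : m + b ∈ K := by
    refine ⟨fun a c => ?_, fun a c hac => ?_, fun a => ?_, fun c => ?_⟩
    · have := hm.1 a c
      simp only [b, Pi.add_apply]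
      split_ifs <;> linarith
    · have h0 := hm.2.1 a c hac
      have : ¬(a = u ∧ c = v) := by
        rintro ⟨rfl, rfl⟩
        exact hac huv
      simp only [b, Pi.add_apply, h0]
      split_ifs <;> simp_all
    · simp only [Pi.add_apply, Finset.sum_add_distrib, hrow]
      split_ifs with h
      · rw [h]; exact hη1
      · simpa using hm.2.2.1 a
    · simp only [Pi.add_apply, Finset.sum_add_distrib, hcol]
      split_ifs with h
      · rw [h]; exact hη2
      · simpa using hm.2.2.2 c
  have := hmax hmem
  simp only [Set.mem_ofPred_eq, Pi.add_apply, Finset.sum_add_distrib, hrow, Finset.sum_ite_eq',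
    Finset.mem_univ, if_true] at this
  linarith

lemma posSemidef_of_pow {n : Type*} [Fintype n] {G : Matrix n n ℝ} (hG : G.PosSemidef) (k : ℕ) :
    (Matrix.of fun i j => G i j ^ k).PosSemidef := by
  induction k with
  | zero =>
    have : (Matrix.of fun i j => G i j ^ 0) = Matrix.vecMulVec (1 : n → ℝ) (star 1) := by
      ext i j
      simp [Matrix.vecMulVec]
    rw [this]
    exact Matrix.posSemidef_vecMulVec_self_star _
  | succ k ih =>
    have h := (ih.kronecker hG).submatrix fun i => (i, i)
    convert! h using 1
/-- Gaussian-type kernels on unit vectors are realised by finite-dimensional vectors. -/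
lemma exists_exp_inner_vectors {V H : Type*} [Fintype V] [NormedAddCommGroup H]
    [InnerProductSpace ℝ H] (x : V → H) (hx : ∀ u, ‖x u‖ = 1) {γ : ℝ} (hγ : 0 ≤ γ) :
    ∃ (N : ℕ) (y : V → Fin N → ℝ),
      ∀ u v, ∑ i, y u i * y v i = Real.exp (-(γ * ‖x u - x v‖ ^ 2)) := by
  have hG := Matrix.posSemidef_gram ℝ x
  have hK : (Matrix.of fun u v => Real.exp (-(γ * ‖x u - x v‖ ^ 2))).PosSemidef := by
    refine .of_dotProduct_mulVec_nonneg ?_ fun a => ?_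
    · ext u v
      simp [norm_sub_rev]
    · have hsum : HasSum (fun k : ℕ => Real.exp (-(2 * γ)) * ((2 * γ) ^ k / k.factorial *
          (star a ⬝ᵥ (Matrix.of fun u v => Matrix.gram ℝ x u v ^ k).mulVec a)))
          (star a ⬝ᵥ (Matrix.of fun u v => Real.exp (-(γ * ‖x u - x v‖ ^ 2))).mulVec a) := by
        simp only [dotProduct, Matrix.mulVec, Matrix.of_apply, Finset.mul_sum]
        refine hasSum_sum fun u _ => hasSum_sum fun v _ => ?_
        have h := (NormedSpace.expSeries_div_hasSum_exp (2 * γ * ⟪x u, x v⟫)).mul_left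
          (Real.exp (-(2 * γ)) * (star a u * a v))
        rw [← Real.exp_eq_exp_ℝ] at h
        have e : Real.exp (-(γ * ‖x u - x v‖ ^ 2)) =
            Real.exp (-(2 * γ)) * Real.exp (2 * γ * ⟪x u, x v⟫) := by
          rw [← Real.exp_add, norm_sub_sq_real, hx, hx]
          congr 1
          ring
        rw [e]
        convert! h using 1
        · ext k
          simp only [Matrix.gram, Matrix.of_apply, mul_pow]
          ring
        · ring
      refine hsum.nonneg fun k => ?_
      have := (posSemidef_of_pow hG k).dotProduct_mulVec_nonneg a
      positivity
  obtain ⟨N, v, hv⟩ := Matrix.posSemidef_iff_eq_sum_vecMulVec.1 hK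
  refine ⟨N, fun u i => v i u, fun u w => ?_⟩
  have := congrFun (congrFun hv u) w
  simp only [Matrix.of_apply, Matrix.sum_apply, Matrix.vecMulVec_apply,
    star_trivial] at this
  exact this.symm

/-- A Rademacher sum of variance between `1` and `4` exceeds `1/2` with constant probability. -/
lemma le_expect_rademacherSum_ge_half {N : ℕ} (a : Fin N → ℝ) (h1 : 1 ≤ ∑ i, a i ^ 2)
    (h4 : ∑ i, a i ^ 2 ≤ 4) :
    1 / (192 * Real.exp 2) ≤ 𝔼 ε, (if 1 / 2 ≤ rademacherSum a ε then (1 : ℝ) else 0) := by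
  set θ : ℝ := 1 / (192 * Real.exp 2) with hθ
  have hθ0 : 0 < θ := by positivity
  set p := 𝔼 ε, (if 1 / 2 ≤ rademacherSum a ε then (1 : ℝ) else 0) with hp
  have hneg : 𝔼 ε, (if 1 / 2 ≤ -rademacherSum a ε then (1 : ℝ) else 0) = p := by
    rw [hp, ← expect_bool_not]
    simp only [rademacherSum_not, neg_neg]
  have hexp : 𝔼 ε, Real.exp (rademacherSum a ε) ≤ Real.exp 2 :=
    (expect_exp_rademacherSum_le a).trans (Real.exp_le_exp.2 (by linarith))
  have hexpn : 𝔼 ε, Real.exp (-rademacherSum a ε) = 𝔼 ε, Real.exp (rademacherSum a ε) := by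
    rw [← expect_bool_not]
    simp only [rademacherSum_not, neg_neg]
  have hpt (t : ℝ) : t ^ 2 ≤ 1 / 4 + θ * 24 * (Real.exp t + Real.exp (-t)) +
      1 / (4 * θ) * ((if 1 / 2 ≤ t then (1 : ℝ) else 0) + (if 1 / 2 ≤ -t then 1 else 0)) := by
    have hE : t ^ 4 ≤ 24 * (Real.exp t + Real.exp (-t)) := by
      have h := Real.pow_div_factorial_le_exp |t| (abs_nonneg t) 4
      have h2 : Real.exp |t| ≤ Real.exp t + Real.exp (-t) := by
        rcases abs_choice t with h | h <;> rw [h] <;>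
          linarith [Real.exp_pos t, Real.exp_pos (-t)]
      have h3 : |t| ^ 4 = t ^ 4 := by rw [pow_abs, abs_of_nonneg (by positivity)]
      rw [h3] at h
      norm_num [Nat.factorial] at h
      linarith
    have hE' : θ * t ^ 4 ≤ θ * 24 * (Real.exp t + Real.exp (-t)) := by
      rw [mul_assoc]; gcongr
    have hEpos : 0 ≤ θ * 24 * (Real.exp t + Real.exp (-t)) := by positivity
    have hamgm : t ^ 2 ≤ θ * t ^ 4 + 1 / (4 * θ) := by
      have : θ * t ^ 4 + 1 / (4 * θ) - t ^ 2 = (2 * θ * t ^ 2 - 1) ^ 2 / (4 * θ) := by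
        field_simp
        ring
      have : 0 ≤ (2 * θ * t ^ 2 - 1) ^ 2 / (4 * θ) := by positivity
      linarith
    have hq : 0 < 1 / (4 * θ) := by positivity
    by_cases ha : 1 / 2 ≤ t
    · rw [if_pos ha, if_neg (by linarith)]
      linarith
    · by_cases hb : 1 / 2 ≤ -t
      · rw [if_neg ha, if_pos hb]
        linarith
      · rw [if_neg ha, if_neg hb]
        nlinarith
  have hmain : ∑ i, a i ^ 2 ≤ 1 / 4 + θ * 24 * (Real.exp 2 + Real.exp 2) +
      1 / (4 * θ) * (p + p) := by
    rw [← expect_rademacherSum_sq]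
    refine (Finset.expect_le_expect fun ε _ => hpt (rademacherSum a ε)).trans ?_
    rw [Finset.expect_add_distrib, Finset.expect_add_distrib, Fintype.expect_const,
      ← Finset.mul_expect, ← Finset.mul_expect, Finset.expect_add_distrib,
      Finset.expect_add_distrib, hneg, hexpn, ← hp]
    gcongr
  have e1 : θ * 24 * (Real.exp 2 + Real.exp 2) = 1 / 4 := by
    rw [hθ]; field_simp; norm_num
  have e2 : 1 / (4 * θ) * (p + p) = p / (2 * θ) := by field_simp; ring
  rw [e1, e2] at hmain
  have : 1 / 2 ≤ p / (2 * θ) := by linarith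
  rw [le_div_iff₀ (by positivity)] at this
  linarith

/-- Two Rademacher projections of well-separated unit vectors are separated, with constant
probability, by a gap at one of boundedly many thresholds. -/
lemma exists_threshold_separation : ∃ (c : ℝ) (J : Finset ℤ), 0 < c ∧ c < 1 ∧ J.Nonempty ∧
    ∀ (N : ℕ) (a b : Fin N → ℝ), ∑ i, a i ^ 2 = 1 → ∑ i, b i ^ 2 = 1 →
      1 ≤ ∑ i, (a i - b i) ^ 2 →
      c ≤ ∑ j ∈ J, 𝔼 ε, (if rademacherSum a ε ≤ j / 4 ∧ j / 4 + 1 / 4 ≤ rademacherSum b ε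
        then (1 : ℝ) else 0) := by
  set θ : ℝ := 1 / (192 * Real.exp 2) with hθ
  have hθ0 : 0 < θ := by positivity
  have hθ1 : θ < 1 := by
    rw [hθ, div_lt_one (by positivity)]
    linarith [Real.add_one_le_exp (2 : ℝ)]
  set K : ℕ := ⌈4 / θ⌉₊ with hK
  have hKθ : 4 / θ ≤ K := Nat.le_ceil _
  have hK1 : (1 : ℝ) ≤ K := by
    have : 1 ≤ 4 / θ := by rw [le_div_iff₀ hθ0]; linarith
    linarith
  have hK0 : (0 : ℝ) < K := by linarith
  refine ⟨θ / 2, Finset.Icc (-4 * K) (4 * K), by positivity, by linarith,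
    Finset.nonempty_Icc.2 (by omega), fun N a b ha hb hab => ?_⟩
  have hba : ∑ i, (b - a) i ^ 2 = ∑ i, (a i - b i) ^ 2 :=
    Finset.sum_congr rfl fun i _ => by simp only [Pi.sub_apply]; ring
  have h4 : ∑ i, (b - a) i ^ 2 ≤ 4 := by
    calc _ ≤ ∑ i, (2 * b i ^ 2 + 2 * a i ^ 2) :=
          Finset.sum_le_sum fun i _ => by
            simp only [Pi.sub_apply]; nlinarith [sq_nonneg (b i + a i)]
      _ = 4 := by rw [Finset.sum_add_distrib, ← Finset.mul_sum, ← Finset.mul_sum, ha, hb]; norm_num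
  have hP := le_expect_rademacherSum_ge_half (b - a) (hba ▸ hab) h4
  have hpt (s t : ℝ) : (if 1 / 2 ≤ t - s then (1 : ℝ) else 0) ≤
      ∑ j ∈ Finset.Icc (-4 * K : ℤ) (4 * K), (if s ≤ j / 4 ∧ (j : ℝ) / 4 + 1 / 4 ≤ t
        then (1 : ℝ) else 0) + (s ^ 2 / K ^ 2 + t ^ 2 / K ^ 2) := by
    have hS : 0 ≤ ∑ j ∈ Finset.Icc (-4 * K : ℤ) (4 * K),
        (if s ≤ j / 4 ∧ (j : ℝ) / 4 + 1 / 4 ≤ t then (1 : ℝ) else 0) :=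
      Finset.sum_nonneg fun j _ => by split_ifs <;> norm_num
    have hs0 : 0 ≤ s ^ 2 / (K : ℝ) ^ 2 := by positivity
    have ht0 : 0 ≤ t ^ 2 / (K : ℝ) ^ 2 := by positivity
    split_ifs with h
    · by_cases hs : |s| ≤ K
      · by_cases ht : |t| ≤ K
        · have hs' := abs_le.1 hs
          have ht' := abs_le.1 ht
          have hc1 := Int.le_ceil (4 * s)
          have hc2 := Int.ceil_lt_add_one (4 * s)
          have hmem : ⌈4 * s⌉ ∈ Finset.Icc (-4 * K : ℤ) (4 * K) := by
            rw [Finset.mem_Icc]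
            constructor
            · have : ((-4 * K : ℤ) : ℝ) ≤ ⌈4 * s⌉ := by push_cast; linarith
              exact_mod_cast this
            · refine Int.ceil_le.2 ?_
              push_cast
              linarith
          have hsum := Finset.single_le_sum (f := fun j : ℤ =>
            if s ≤ j / 4 ∧ (j : ℝ) / 4 + 1 / 4 ≤ t then (1 : ℝ) else 0)
            (fun j _ => by split_ifs <;> norm_num) hmem
          rw [if_pos ⟨by linarith, by linarith⟩] at hsum
          linarith
        · have : 1 ≤ t ^ 2 / (K : ℝ) ^ 2 := by
            rw [one_le_div (by positivity), ← sq_abs t]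
            exact pow_le_pow_left₀ hK0.le (not_le.1 ht).le 2
          linarith
      · have : 1 ≤ s ^ 2 / (K : ℝ) ^ 2 := by
          rw [one_le_div (by positivity), ← sq_abs s]
          exact pow_le_pow_left₀ hK0.le (not_le.1 hs).le 2
        linarith
    · linarith
  simp only [rademacherSum_sub] at hP
  have hmain := hP.trans (Finset.expect_le_expect fun ε _ =>
    hpt (rademacherSum a ε) (rademacherSum b ε))
  rw [Finset.expect_add_distrib, Finset.expect_add_distrib, ← Finset.expect_div,
    ← Finset.expect_div, expect_rademacherSum_sq, expect_rademacherSum_sq, ha, hb,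
    Finset.expect_sum_comm] at hmain
  have hKK : 1 / (K : ℝ) ^ 2 ≤ θ / 4 := by
    have h5 : 4 / θ ≤ (K : ℝ) ^ 2 := by nlinarith
    rw [div_le_iff₀ hθ0] at h5
    rw [div_le_iff₀ (by positivity)]
    linarith
  linarith

/-- The squared Euclidean distance between two vectors of a family. -/
def distSq {V : Type*} {N : ℕ} (y : V → Fin N → ℝ) (u v : V) : ℝ :=
  ∑ i, (y u i - y v i) ^ 2

lemma distSq_self {V : Type*} {N : ℕ} (y : V → Fin N → ℝ) (u : V) : distSq y u u = 0 := by
  simp [distSq]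

lemma distSq_comm {V : Type*} {N : ℕ} (y : V → Fin N → ℝ) (u v : V) :
    distSq y u v = distSq y v u :=
  Finset.sum_congr rfl fun _ _ => by ring

lemma distSq_ball_nonempty {V : Type*} [Fintype V] {N : ℕ} (y : V → Fin N → ℝ) {r : ℝ}
    (hr : 0 ≤ r) (u : V) : (Finset.univ.filter fun v => distSq y u v ≤ r).Nonempty :=
  ⟨u, by simpa [distSq_self] using hr⟩

/-- The largest increment of the random projection from `u` to a point of the `distSq`-ball of
radius `r` around `u`. -/
def ballSup {V : Type*} [Fintype V] {N : ℕ} (y : V → Fin N → ℝ) {r : ℝ} (hr : 0 ≤ r) (u : V)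
    (ε : Fin N → Bool) : ℝ :=
  (Finset.univ.filter fun v => distSq y u v ≤ r).sup' (distSq_ball_nonempty y hr u)
    fun v => rademacherSum (y v - y u) ε

section Chaining

variable {V : Type*} [Fintype V] {N : ℕ} {y : V → Fin N → ℝ}

lemma le_ballSup {r : ℝ} (hr : 0 ≤ r) {u v : V} (huv : distSq y u v ≤ r) (ε : Fin N → Bool) :
    rademacherSum (y v) ε - rademacherSum (y u) ε ≤ ballSup y hr u ε := by
  rw [← rademacherSum_sub]
  exact Finset.le_sup' (fun v => rademacherSum (y v - y u) ε) (by simpa using huv)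

lemma ballSup_nonneg {r : ℝ} (hr : 0 ≤ r) (u : V) (ε : Fin N → Bool) : 0 ≤ ballSup y hr u ε := by
  have := le_ballSup (y := y) hr (u := u) (v := u) (by rwa [distSq_self]) ε
  simpa using this

lemma ballSup_step (htri : ∀ u v w, distSq y u w ≤ distSq y u v + distSq y v w)
    {r s : ℝ} (hr : 0 ≤ r) (hs : 0 ≤ s) {δ : ℝ} (hrs : r + δ ≤ s)
    {u v : V} (huv : distSq y u v ≤ δ) (ε : Fin N → Bool) :
    ballSup y hr v ε + (rademacherSum (y v) ε - rademacherSum (y u) ε) ≤ ballSup y hs u ε := by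
  obtain ⟨z, hz, hze⟩ := Finset.exists_mem_eq_sup' (distSq_ball_nonempty y hr v)
    fun z => rademacherSum (y z - y v) ε
  have hz' : distSq y v z ≤ r := by simpa using hz
  have h := le_ballSup (y := y) hs (u := u) (v := z) (by linarith [htri u v z]) ε
  have h2 : ballSup y hr v ε = rademacherSum (y z - y v) ε := hze
  rw [h2, rademacherSum_sub]
  linarith

lemma distSq_ball_le {r : ℝ} {u : V} :
    ∀ v ∈ Finset.univ.filter fun v => distSq y u v ≤ r, ∑ i, (y v - y u) i ^ 2 ≤ r := by
  intro v hv
  have : distSq y u v ≤ r := by simpa using hv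
  rw [distSq_comm] at this
  exact this

lemma expect_abs_ballSup_sub_le {r : ℝ} (hr : 0 ≤ r) (u : V) :
    𝔼 ε, |ballSup y hr u ε - 𝔼 ε', ballSup y hr u ε'| ≤ √(2 * r) :=
  Real.le_sqrt_of_sq_le (expect_abs_sub_sup'_rademacherSum_sq_le (distSq_ball_nonempty y hr u)
    (fun v => y v - y u) distSq_ball_le)

lemma expect_ballSup_le {r : ℝ} (hr : 0 < r) (hV : 2 ≤ Fintype.card V) (u : V) :
    𝔼 ε, ballSup y hr.le u ε ≤ √(2 * r * Real.log (Fintype.card V)) :=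
  expect_sup'_rademacherSum_le (distSq_ball_nonempty y hr.le u) (fun v => y v - y u) hr
    (by exact_mod_cast hV) distSq_ball_le (by exact_mod_cast Finset.card_le_univ _)

/-- One step of the chaining argument: enlarging the balls by `δ` increases the average supremum
by the gain along a skew-symmetric random fractional matching, up to the fluctuations of the
suprema. -/
lemma sum_expect_ballSup_step (htri : ∀ u v w, distSq y u w ≤ distSq y u v + distSq y v w)
    {r s δ σ : ℝ} (hr : 0 ≤ r) (hs : 0 ≤ s) (hδ : 0 ≤ δ) (hrs : r + δ ≤ s)
    (μ : V → ℝ) (m : (Fin N → Bool) → V → V → ℝ) (hm0 : ∀ ε u v, 0 ≤ m ε u v)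
    (hmE : ∀ ε u v, m ε u v ≠ 0 →
      distSq y u v ≤ δ ∧ σ ≤ rademacherSum (y v) ε - rademacherSum (y u) ε)
    (hrow : ∀ ε u, ∑ v, m ε u v ≤ μ u) (hcol : ∀ ε v, ∑ u, m ε u v ≤ μ v)
    (hskew : ∀ ε u v, m (fun i => !ε i) v u = m ε u v) :
    ∑ u, μ u * 𝔼 ε, ballSup y hr u ε + σ * 𝔼 ε, ∑ u, ∑ v, m ε u v - (∑ u, μ u) * √(2 * r) ≤
      ∑ u, μ u * 𝔼 ε, ballSup y hs u ε := by
  set e : V → ℝ := fun u => 𝔼 ε, ballSup y hr u ε with he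
  have hpt (ε : Fin N → Bool) :
      ∑ u, (μ u * ballSup y hr u ε + (∑ v, m ε v u - ∑ v, m ε u v) * e u -
        μ u * |ballSup y hr u ε - e u|) + σ * ∑ u, ∑ v, m ε u v ≤
      ∑ u, μ u * ballSup y hs u ε := by
    have h1 (u : V) : (μ u - ∑ v, m ε u v) * ballSup y hr u ε +
        ∑ v, m ε u v * (ballSup y hr v ε + σ) ≤ μ u * ballSup y hs u ε := by
      have ha := ballSup_step htri hr hs hrs (u := u) (v := u) (by rwa [distSq_self]) ε
      have hb : ∑ v, m ε u v * (ballSup y hr v ε + σ) ≤ ∑ v, m ε u v * ballSup y hs u ε := by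
        refine Finset.sum_le_sum fun v _ => ?_
        by_cases hm : m ε u v = 0
        · simp [hm]
        · obtain ⟨hd, hg⟩ := hmE ε u v hm
          have := ballSup_step htri hr hs hrs hd ε
          exact mul_le_mul_of_nonneg_left (by linarith) (hm0 ε u v)
      rw [← Finset.sum_mul] at hb
      have hc := mul_le_mul_of_nonneg_left (by linarith : ballSup y hr u ε ≤ ballSup y hs u ε)
        (sub_nonneg.2 (hrow ε u))
      linarith
    have h2 := Finset.sum_le_sum fun u (_ : u ∈ Finset.univ) => h1 u
    refine le_trans ?_ h2
    have h3 : ∑ u, ∑ v, m ε u v * (ballSup y hr v ε + σ) =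
        ∑ u, (∑ v, m ε v u) * ballSup y hr u ε + σ * ∑ u, ∑ v, m ε u v := by
      simp only [mul_add, Finset.sum_add_distrib, Finset.mul_sum, Finset.sum_mul]
      rw [Finset.sum_comm]
      congr 1
      exact Finset.sum_congr rfl fun _ _ => Finset.sum_congr rfl fun _ _ => mul_comm _ _
    rw [Finset.sum_add_distrib, h3, ← add_assoc, ← Finset.sum_add_distrib]
    gcongr with u
    have hR0 : 0 ≤ ∑ v, m ε v u := Finset.sum_nonneg fun v _ => hm0 ε v u
    have hL0 : 0 ≤ ∑ v, m ε u v := Finset.sum_nonneg fun v _ => hm0 ε u v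
    have hdiff : |∑ v, m ε v u - ∑ v, m ε u v| ≤ μ u :=
      abs_le.2 ⟨by linarith [hrow ε u], by linarith [hcol ε u]⟩
    have hprod : -(μ u * |ballSup y hr u ε - e u|) ≤
        (∑ v, m ε v u - ∑ v, m ε u v) * (ballSup y hr u ε - e u) := by
      have := neg_abs_le ((∑ v, m ε v u - ∑ v, m ε u v) * (ballSup y hr u ε - e u))
      rw [abs_mul] at this
      have := mul_le_mul_of_nonneg_right hdiff (abs_nonneg (ballSup y hr u ε - e u))
      linarith
    linarith
  have hexp := Finset.expect_le_expect fun ε (_ : ε ∈ Finset.univ) => hpt ε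
  have hbal (u : V) : 𝔼 ε, ∑ v, m ε v u = 𝔼 ε, ∑ v, m ε u v := by
    rw [← expect_bool_not]
    exact Finset.expect_congr rfl fun ε _ => Finset.sum_congr rfl fun v _ => hskew ε u v
  rw [Finset.expect_add_distrib, Finset.expect_sum_comm, Finset.expect_sum_comm,
    ← Finset.mul_expect] at hexp
  simp only [Finset.expect_sub_distrib, Finset.expect_add_distrib, ← Finset.mul_expect,
    ← Finset.expect_mul, hbal, sub_self, zero_mul, add_zero] at hexp
  refine le_trans ?_ hexp
  rw [Finset.sum_sub_distrib, Finset.sum_mul]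
  have hμ0 (u : V) : 0 ≤ μ u :=
    (Finset.sum_nonneg fun v _ => hm0 (fun _ => true) u v).trans (hrow (fun _ => true) u)
  have : ∑ u, μ u * 𝔼 ε, |ballSup y hr u ε - e u| ≤ ∑ u, μ u * √(2 * r) :=
    Finset.sum_le_sum fun u _ =>
      mul_le_mul_of_nonneg_left (expect_abs_ballSup_sub_le hr u) (hμ0 u)
  linarith

/-- A skew-symmetric random fractional matching along short edges with large projection cannot be
large. -/
lemma fractional_matching_bound (htri : ∀ u v w, distSq y u w ≤ distSq y u v + distSq y v w)
    (hV : 2 ≤ Fintype.card V) {δ σ : ℝ} (hδ : 0 < δ)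
    (μ : V → ℝ) (m : (Fin N → Bool) → V → V → ℝ) (hm0 : ∀ ε u v, 0 ≤ m ε u v)
    (hmE : ∀ ε u v, m ε u v ≠ 0 →
      distSq y u v ≤ δ ∧ σ ≤ rademacherSum (y v) ε - rademacherSum (y u) ε)
    (hrow : ∀ ε u, ∑ v, m ε u v ≤ μ u) (hcol : ∀ ε v, ∑ u, m ε u v ≤ μ v)
    (hskew : ∀ ε u v, m (fun i => !ε i) v u = m ε u v) {T : ℕ} (hT : 0 < T) :
    T * (σ * 𝔼 ε, ∑ u, ∑ v, m ε u v - (∑ u, μ u) * √(2 * (T * δ))) ≤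
      (∑ u, μ u) * √(2 * (T * δ) * Real.log (Fintype.card V)) := by
  have hμ0 (u : V) : 0 ≤ μ u :=
    (Finset.sum_nonneg fun v _ => hm0 (fun _ => true) u v).trans (hrow (fun _ => true) u)
  have hW : 0 ≤ ∑ u, μ u := Finset.sum_nonneg fun u _ => hμ0 u
  have hnn (k : ℕ) : 0 ≤ k * δ := by positivity
  have hind (k : ℕ) (hk : k ≤ T) :
      k * (σ * 𝔼 ε, ∑ u, ∑ v, m ε u v - (∑ u, μ u) * √(2 * (T * δ))) ≤
        ∑ u, μ u * 𝔼 ε, ballSup y (hnn k) u ε := by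
    induction k with
    | zero =>
      refine (by simp : _ ≤ (0 : ℝ)).trans ?_
      exact Finset.sum_nonneg fun u _ => mul_nonneg (hμ0 u)
        (Finset.expect_nonneg fun ε _ => ballSup_nonneg _ u ε)
    | succ k ih =>
      have h1 := ih (by omega)
      have h2 := sum_expect_ballSup_step htri (hnn k) (hnn (k + 1)) hδ.le
        (by push_cast; linarith) μ m hm0 hmE hrow hcol hskew
      have h3 : √(2 * (k * δ)) ≤ √(2 * (T * δ)) := by
        have : (k : ℝ) ≤ T := by exact_mod_cast (by omega : k ≤ T)
        gcongr
      have h4 := mul_le_mul_of_nonneg_left h3 hW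
      push_cast at h2 ⊢
      linarith
  refine (hind T le_rfl).trans ?_
  rw [Finset.sum_mul]
  refine Finset.sum_le_sum fun u _ => mul_le_mul_of_nonneg_left ?_ (hμ0 u)
  exact expect_ballSup_le (mul_pos (by exact_mod_cast hT) hδ) hV u

end Chaining

/-- The structure theorem of Arora, Rao and Vazirani, in weighted form: for unit vectors whose
squared distances form a metric and a weighting of well-separated pairs, some set `Z` contains the
first point of a constant fraction of the pairs while being far from the second. -/
lemma exists_separating_set : ∃ p κ : ℝ, 0 < p ∧ p < 1 / 2 ∧ 0 < κ ∧
    ∀ {V P : Type} [Fintype V] [Fintype P] {N : ℕ} (y : V → Fin N → ℝ) (src tgt : P → V)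
      (w : P → ℝ), 2 ≤ Fintype.card V → (∀ u, ∑ i, y u i ^ 2 = 1) →
      (∀ u v w, distSq y u w ≤ distSq y u v + distSq y v w) →
      (∀ q, 1 ≤ distSq y (src q) (tgt q)) → (∀ q, 0 ≤ w q) → ∑ q, w q = 1 →
      ∃ Z : Finset V, p ≤ ∑ q, w q * (if src q ∈ Z ∧
        ∀ z ∈ Z, κ / (⌊√(Real.log (Fintype.card V))⌋₊ + 1 : ℕ) < distSq y z (tgt q)
          then 1 else 0) := by
  obtain ⟨c, J, hc, hc1, hJ, hsep⟩ := exists_threshold_separation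
  have hJ1 : (1 : ℝ) ≤ J.card := by exact_mod_cast hJ.card_pos
  set c' : ℝ := c / J.card with hc'
  have hc'0 : 0 < c' := by positivity
  have hc'1 : c' < 1 := by
    rw [hc', div_lt_one (by linarith)]
    linarith
  refine ⟨c' / 2, (c' / 16) ^ 2 / 32, by positivity, by linarith, by positivity, ?_⟩
  intro V P _ _ N y src tgt w hV hy htri hd hw hw1
  set T : ℕ := ⌊√(Real.log (Fintype.card V))⌋₊ + 1 with hT
  have hT0 : (0 : ℝ) < T := by rw [hT]; positivity
  set δ : ℝ := (c' / 16) ^ 2 / 32 / T with hδ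
  have hδ0 : 0 < δ := by positivity
  by_contra! hcon
  obtain ⟨j, hjJ, hj⟩ : ∃ j ∈ J, c' ≤ ∑ q, w q * 𝔼 ε, (if rademacherSum (y (src q)) ε ≤ j / 4 ∧
      (j : ℝ) / 4 + 1 / 4 ≤ rademacherSum (y (tgt q)) ε then (1 : ℝ) else 0) := by
    refine Finset.exists_le_of_sum_le hJ ?_
    rw [Finset.sum_const, nsmul_eq_mul, hc', mul_div_cancel₀ _ (by linarith), Finset.sum_comm]
    calc c = ∑ q, w q * c := by rw [← Finset.sum_mul, hw1, one_mul]
      _ ≤ _ := by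
        refine Finset.sum_le_sum fun q _ => ?_
        rw [← Finset.mul_sum]
        exact mul_le_mul_of_nonneg_left (hsep N _ _ (hy _) (hy _) (hd q)) (hw q)
  set a : ℝ := (j : ℝ) / 4 with ha
  set μ : V → ℝ := fun u => ∑ q, w q * ((if src q = u then 1 else 0) +
    (if tgt q = u then 1 else 0)) with hμ
  have hμ0 (u : V) : 0 ≤ μ u := Finset.sum_nonneg fun q _ => mul_nonneg (hw q)
    (add_nonneg (by split_ifs <;> norm_num) (by split_ifs <;> norm_num))
  have hμ2 : ∑ u, μ u = 2 := by
    rw [hμ, Finset.sum_comm]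
    simp only [← Finset.mul_sum, Finset.sum_add_distrib, Finset.sum_ite_eq, Finset.mem_univ,
      if_true, ← Finset.sum_mul, hw1]
    norm_num
  have hmass (f : P → V) (hf : f = src ∨ f = tgt) (R : V → Prop) :
      ∑ q, w q * (if R (f q) then (1 : ℝ) else 0) ≤ ∑ u, if R u then μ u else 0 := by
    have h1 (q : P) : (if R (f q) then (1 : ℝ) else 0) =
        ∑ u, if R u then (if f q = u then (1 : ℝ) else 0) else 0 := by
      rw [Finset.sum_eq_single (f q)]
      · simp
      · intro u _ hu
        simp [hu.symm]
      · simp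
    simp only [h1, Finset.mul_sum]
    rw [Finset.sum_comm]
    refine Finset.sum_le_sum fun u _ => ?_
    split_ifs
    · refine Finset.sum_le_sum fun q _ => mul_le_mul_of_nonneg_left ?_ (hw q)
      rcases hf with rfl | rfl
      · exact le_add_of_nonneg_right (by split_ifs <;> norm_num)
      · exact le_add_of_nonneg_left (by split_ifs <;> norm_num)
    · simp
  choose m hm0 hmE hrow hcol hmax using fun ε : Fin N → Bool =>
    exists_maximal_fractional_matching (fun u v => rademacherSum (y u) ε ≤ a ∧
      a + 1 / 4 ≤ rademacherSum (y v) ε ∧ distSq y u v ≤ δ) μ hμ0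
  have hpt (ε : Fin N → Bool) : ∑ q, w q * (if rademacherSum (y (src q)) ε ≤ a ∧
      a + 1 / 4 ≤ rademacherSum (y (tgt q)) ε then (1 : ℝ) else 0) ≤
      c' / 2 + 2 * ∑ u, ∑ v, m ε u v := by
    have hZ := (hcon (Finset.univ.filter fun u => rademacherSum (y u) ε ≤ a ∧
      ∑ v, m ε u v ≠ μ u)).le
    have hR : ∑ q, w q * (if ∑ v, m ε (src q) v = μ (src q) then (1 : ℝ) else 0) ≤
        ∑ u, ∑ v, m ε u v := by
      refine (hmass src (.inl rfl) fun u => ∑ v, m ε u v = μ u).trans ?_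
      refine Finset.sum_le_sum fun u _ => ?_
      split_ifs with h
      · exact h.ge
      · exact Finset.sum_nonneg fun v _ => hm0 ε u v
    have hC : ∑ q, w q * (if ∑ u, m ε u (tgt q) = μ (tgt q) then (1 : ℝ) else 0) ≤
        ∑ u, ∑ v, m ε u v := by
      refine (hmass tgt (.inr rfl) fun v => ∑ u, m ε u v = μ v).trans ?_
      rw [Finset.sum_comm]
      refine Finset.sum_le_sum fun v _ => ?_
      split_ifs with h
      · exact h.ge
      · exact Finset.sum_nonneg fun u _ => hm0 ε u v
    have hsum := add_le_add (add_le_add hZ hR) hC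
    rw [← Finset.sum_add_distrib, ← Finset.sum_add_distrib] at hsum
    refine le_trans (Finset.sum_le_sum fun q _ => ?_) (hsum.trans (by linarith))
    rw [← mul_add, ← mul_add]
    refine mul_le_mul_of_nonneg_left ?_ (hw q)
    have n1 {R : Prop} {_ : Decidable R} : (0 : ℝ) ≤ if R then 1 else 0 := by split_ifs <;> norm_num
    by_cases hs : ∑ v, m ε (src q) v = μ (src q)
    · rw [if_pos hs]
      have : (if rademacherSum (y (src q)) ε ≤ a ∧ a + 1 / 4 ≤ rademacherSum (y (tgt q)) ε
        then (1 : ℝ) else 0) ≤ 1 := by split_ifs <;> norm_num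
      exact this.trans (le_add_of_le_of_nonneg (le_add_of_nonneg_left n1) n1)
    · by_cases ht : ∑ u, m ε u (tgt q) = μ (tgt q)
      · rw [if_pos ht]
        have : (if rademacherSum (y (src q)) ε ≤ a ∧ a + 1 / 4 ≤ rademacherSum (y (tgt q)) ε
          then (1 : ℝ) else 0) ≤ 1 := by split_ifs <;> norm_num
        exact this.trans (le_add_of_nonneg_left (add_nonneg n1 n1))
      · rw [if_neg hs, if_neg ht, add_zero, add_zero]
        by_cases hab : rademacherSum (y (src q)) ε ≤ a ∧ a + 1 / 4 ≤ rademacherSum (y (tgt q)) ε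
        · rw [if_pos hab, if_pos]
          refine ⟨by simpa using ⟨hab.1, hs⟩, fun z hz => ?_⟩
          have hz' : rademacherSum (y z) ε ≤ a ∧ ∑ v, m ε z v ≠ μ z := by simpa using hz
          by_contra! hle
          rcases hmax ε z (tgt q) ⟨hz'.1, hab.2, hle⟩ with h | h
          · exact hz'.2 h
          · exact ht h
        · rw [if_neg hab]
          exact n1
  have hM : c' ≤ c' / 2 + 2 * 𝔼 ε, ∑ u, ∑ v, m ε u v := by
    refine hj.trans ?_
    simp only [Finset.mul_expect]
    rw [← Finset.expect_sum_comm]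
    refine (Finset.expect_le_expect fun ε _ => hpt ε).trans (le_of_eq ?_)
    rw [Finset.expect_add_distrib, Fintype.expect_const, ← Finset.mul_expect]
  set m' : (Fin N → Bool) → V → V → ℝ := fun ε u v =>
    (m ε u v + m (fun i => !ε i) v u) / 2 with hm'
  have hM' : 𝔼 ε, ∑ u, ∑ v, m' ε u v = 𝔼 ε, ∑ u, ∑ v, m ε u v := by
    have h1 : 𝔼 ε : Fin N → Bool, ∑ u, ∑ v, m (fun i => !ε i) v u = 𝔼 ε, ∑ u, ∑ v, m ε u v := by
      rw [← expect_bool_not fun ε => ∑ u, ∑ v, m ε u v]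
      exact Finset.expect_congr rfl fun ε _ => Finset.sum_comm
    simp only [hm', ← Finset.sum_div, Finset.sum_add_distrib, ← Finset.expect_div,
      Finset.expect_add_distrib, h1]
    ring
  have hbound := fractional_matching_bound htri hV hδ0 (σ := 1 / 4) μ m'
    (fun ε u v => div_nonneg (add_nonneg (hm0 _ _ _) (hm0 _ _ _)) (by norm_num))
    (fun ε u v h => by
      by_cases h1 : m ε u v = 0
      · have h2 : m (fun i => !ε i) v u ≠ 0 := by
          intro h2
          simp [hm', h1, h2] at h
        obtain ⟨e1, e2, e3⟩ := hmE _ _ _ h2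
        rw [rademacherSum_not] at e1 e2
        exact ⟨distSq_comm y v u ▸ e3, by linarith⟩
      · obtain ⟨e1, e2, e3⟩ := hmE _ _ _ h1
        exact ⟨e3, by linarith⟩)
    (fun ε u => by
      simp only [hm', ← Finset.sum_div, Finset.sum_add_distrib]
      linarith [hrow ε u, hcol (fun i => !ε i) u])
    (fun ε v => by
      simp only [hm', ← Finset.sum_div, Finset.sum_add_distrib]
      linarith [hcol ε v, hrow (fun i => !ε i) v])
    (fun ε u v => by simp only [hm', Bool.not_not]; ring)
    (T := T) (by omega)
  have hTδ : T * δ = (c' / 16) ^ 2 / 32 := by rw [hδ]; field_simp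
  have hsq : √(2 * ((c' / 16) ^ 2 / 32)) = c' / 64 := by
    rw [show 2 * ((c' / 16) ^ 2 / 32) = (c' / 64) ^ 2 by ring, Real.sqrt_sq (by positivity)]
  have hlt := Nat.lt_floor_add_one √(Real.log (Fintype.card V))
  rw [hTδ, Real.sqrt_mul (x := 2 * ((c' / 16) ^ 2 / 32)) (by positivity)
    (Real.log (Fintype.card V)), hsq, hμ2, hM'] at hbound
  have hTl : √(Real.log (Fintype.card V)) < T := by rw [hT]; push_cast; exact hlt
  nlinarith [mul_lt_mul_of_pos_left hTl hc'0,
    mul_le_mul_of_nonneg_left hM hT0.le]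

/-- The threshold cut: the points at distance at most `τ` from the set `Z`. -/
def thresholdCut {V : Type*} (d : V → V → ℝ) (Z : Finset V) (τ : ℝ) : V → Bool :=
  fun v => decide (∃ z ∈ Z, d z v ≤ τ)

open MeasureTheory in
/-- The law of a random variable with values in a finite type is a probability distribution, and
its probabilities are the expected ones. -/
lemma exists_law {α Ω : Type*} [MeasurableSpace α] [Fintype Ω] (μ : Measure α)
    [IsProbabilityMeasure μ] (f : α → Ω) (hf : ∀ ω, MeasurableSet {t | f t = ω}) :
    ∃ ρ : Ω → ℝ, IsProbDist ρ ∧ ∀ Q : Ω → Prop, Pr ρ Q = μ.real {t | Q (f t)} := by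
  have key (Q : Ω → Prop) : Pr (fun ω => μ.real {t | f t = ω}) Q = μ.real {t | Q (f t)} := by
    rw [Pr, ← Finset.sum_filter, ← measureReal_biUnion_finset]
    · congr 1
      ext t
      simp
    · intro i _ j _ hij
      refine Set.disjoint_left.2 fun t h1 h2 => hij ?_
      exact h1.symm.trans h2
    · exact fun ω _ => hf ω
  refine ⟨_, ⟨fun ω => measureReal_nonneg, ?_⟩, key⟩
  have := key fun _ => True
  simpa [Pr] using this

lemma measurableSet_thresholdCut_eq {V : Type*} [Fintype V] (d : V → V → ℝ) (Z : Finset V)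
    (ω : V → Bool) : MeasurableSet {τ | thresholdCut d Z τ = ω} := by
  have h (v : V) : MeasurableSet {τ | ∃ z ∈ Z, d z v ≤ τ} := by
    have : {τ | ∃ z ∈ Z, d z v ≤ τ} = ⋃ z ∈ Z, Set.Ici (d z v) := by
      ext τ
      simp
    rw [this]
    exact Finset.measurableSet_biUnion _ fun z _ => measurableSet_Ici
  have : {τ | thresholdCut d Z τ = ω} = ⋂ v, {τ | thresholdCut d Z τ v = ω v} := by
    ext τ
    simp [funext_iff]
  rw [this]
  refine MeasurableSet.iInter fun v => ?_
  cases hv : ω v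
  · simpa [thresholdCut, Set.compl_def] using (h v).compl
  · simpa [thresholdCut] using h v

open MeasureTheory ProbabilityTheory in
/-- A uniformly random threshold below `δ` separates points of `Z` from points at distance more
than `δ` from `Z`, and cuts sets of small diameter with small probability. -/
lemma exists_random_thresholdCut {V : Type*} [Fintype V] [DecidableEq V] {d : V → V → ℝ}
    (hself : ∀ u, d u u = 0) (htri : ∀ u v w, d u w ≤ d u v + d v w) {δ : ℝ} (hδ : 0 < δ)
    (Z : Finset V) :
    ∃ ρ : (V → Bool) → ℝ, IsProbDist ρ ∧
      (∀ u v, u ∈ Z → (∀ z ∈ Z, δ < d z v) → Pr ρ (fun ω => ω u ≠ ω v) = 1) ∧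
      ∀ (e : Finset V) (D : ℝ), e.Nonempty → (∀ u ∈ e, ∀ v ∈ e, d u v ≤ D) →
        Pr ρ (fun ω => ∃ u ∈ e, ∃ v ∈ e, ω u ≠ ω v) ≤ D / δ := by
  have hvol : volume (Set.Ioc 0 δ) = ENNReal.ofReal δ := by simp
  have hμ : IsProbabilityMeasure (volume[|Set.Ioc 0 δ]) :=
    cond_isProbabilityMeasure_of_finite (by simpa using hδ) (by simp)
  have happ (S : Set ℝ) : (volume[|Set.Ioc 0 δ]).real S = volume.real (Set.Ioc 0 δ ∩ S) / δ := by
    rw [measureReal_def, cond_apply measurableSet_Ioc, hvol, ENNReal.toReal_mul,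
      ENNReal.toReal_inv, ENNReal.toReal_ofReal hδ.le, div_eq_inv_mul, measureReal_def]
  obtain ⟨ρ, hρ, hPr⟩ := exists_law (volume[|Set.Ioc 0 δ]) (thresholdCut d Z)
    (measurableSet_thresholdCut_eq d Z)
  refine ⟨ρ, hρ, fun u v hu hv => ?_, fun e D he hD => ?_⟩
  · rw [hPr, happ, Set.inter_eq_left.2, Real.volume_real_Ioc_of_le hδ.le, sub_zero,
      div_self hδ.ne']
    intro τ hτ
    have h1 : ∃ z ∈ Z, d z u ≤ τ := ⟨u, hu, (hself u).trans_le hτ.1.le⟩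
    have h2 : ¬ ∃ z ∈ Z, d z v ≤ τ := by
      rintro ⟨z, hz, hzv⟩
      linarith [hv z hz, hτ.2]
    simp only [thresholdCut, Set.mem_ofPred_eq, h1, h2, decide_true, decide_false]
    decide
  · rw [hPr, happ]
    gcongr
    obtain ⟨u₀, hu₀⟩ := he
    have hD0 : 0 ≤ D := (hself u₀).symm.le.trans (hD u₀ hu₀ u₀ hu₀)
    rcases Z.eq_empty_or_nonempty with rfl | hZ
    · simpa [thresholdCut] using hD0
    obtain ⟨⟨z, u⟩, hzu, hmin⟩ := Finset.exists_min_image (Z ×ˢ e) (fun q => d q.1 q.2)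
      (hZ.product ⟨u₀, hu₀⟩)
    rw [Finset.mem_product] at hzu
    have hsub : Set.Ioc 0 δ ∩ {τ | ∃ u ∈ e, ∃ v ∈ e,
        thresholdCut d Z τ u ≠ thresholdCut d Z τ v} ⊆ Set.Ico (d z u) (d z u + D) := by
      rintro τ ⟨-, a, ha, b, hb, hab⟩
      have main (a b : V) (ha : a ∈ e) (hb : b ∈ e) (h1 : ∃ z ∈ Z, d z a ≤ τ)
          (h2 : ¬ ∃ z ∈ Z, d z b ≤ τ) : τ ∈ Set.Ico (d z u) (d z u + D) := by
        obtain ⟨s, hs, hsa⟩ := h1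
        push Not at h2
        have := hmin (s, a) (Finset.mem_product.2 ⟨hs, ha⟩)
        exact ⟨this.trans hsa, (h2 z hzu.1).trans_le
          ((htri z u b).trans (by linarith [hD u hzu.2 b hb]))⟩
      by_cases h1 : ∃ z ∈ Z, d z a ≤ τ <;> by_cases h2 : ∃ z ∈ Z, d z b ≤ τ
      · exact absurd (by simp only [thresholdCut, h1, h2]) hab
      · exact main a b ha hb h1 h2
      · exact main b a hb ha h2 h1
      · exact absurd (by simp only [thresholdCut, h1, h2]) hab
    refine (measureReal_mono hsub (by simp)).trans ?_
    rw [Real.volume_real_Ico_of_le (by linarith)]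
    linarith

/-- Mixing probability distributions. -/
lemma exists_mixture {Ω ι : Type*} [Fintype Ω] [Fintype ι] {q : ι → ℝ} (hq : ∀ i, 0 ≤ q i)
    (hq1 : ∑ i, q i = 1) {ρ : ι → Ω → ℝ} (hρ : ∀ i, IsProbDist (ρ i)) :
    ∃ ν : Ω → ℝ, IsProbDist ν ∧ ∀ Q : Ω → Prop, Pr ν Q = ∑ i, q i * Pr (ρ i) Q := by
  refine ⟨fun ω => ∑ i, q i * ρ i ω,
    ⟨fun ω => Finset.sum_nonneg fun i _ => mul_nonneg (hq i) ((hρ i).1 ω), ?_⟩, fun Q => ?_⟩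
  · rw [Finset.sum_comm]
    simp only [← Finset.mul_sum, (hρ _).2, mul_one, hq1]
  · simp only [Pr, Finset.mul_sum]
    rw [Finset.sum_comm]
    refine Finset.sum_congr rfl fun ω _ => ?_
    split_ifs <;> simp

lemma Pr_nonneg {Ω : Type*} [Fintype Ω] {μ : Ω → ℝ} (hμ : IsProbDist μ) (Q : Ω → Prop) :
    0 ≤ Pr μ Q :=
  Finset.sum_nonneg fun ω _ => by
    split_ifs
    exacts [hμ.1 ω, le_rfl]

lemma le_maxDistSq {V H : Type*} [NormedAddCommGroup H] (x : V → H) {e : Finset V} {u v : V}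
    (hu : u ∈ e) (hv : v ∈ e) : ‖x u - x v‖ ^ 2 ≤ maxDistSq x e := by
  refine le_csSup ?_ ⟨u, hu, v, hv, rfl⟩
  refine (((e ×ˢ e).image fun q => ‖x q.1 - x q.2‖ ^ 2).finite_toSet.subset ?_).bddAbove
  rintro _ ⟨a, ha, b, hb, rfl⟩
  simp only [Finset.coe_image, Set.mem_image, Finset.mem_coe, Finset.mem_product]
  exact ⟨(a, b), ⟨ha, hb⟩, rfl⟩

lemma floor_sqrt_log_add_one_le {n : ℕ} (hn : 2 ≤ n) :
    ((⌊√(Real.log n)⌋₊ + 1 : ℕ) : ℝ) ≤ 2 * √(Real.logb 2 n) := by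
  have hn' : (2 : ℝ) ≤ n := by exact_mod_cast hn
  have h2 : Real.log 2 ≤ 1 := by linarith [Real.log_two_lt_d9]
  have h1 : 1 ≤ √(Real.logb 2 n) := by
    rw [Real.one_le_sqrt, Real.le_logb_iff_rpow_le (by norm_num) (by linarith)]
    simpa using hn'
  have h3 : √(Real.log n) ≤ √(Real.logb 2 n) := by
    refine Real.sqrt_le_sqrt ?_
    rw [Real.logb, le_div_iff₀ (Real.log_pos (by norm_num))]
    exact mul_le_of_le_one_right (Real.log_nonneg (by linarith)) h2
  push_cast
  linarith [Nat.floor_le (Real.sqrt_nonneg (Real.log n))]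

/-- An `ℓ₂²`-metric on unit vectors can be replaced by one, again on unit vectors, in which distance
`β` has become a constant. -/
lemma exists_rescaled_vectors {V H : Type*} [Fintype V] [NormedAddCommGroup H]
    [InnerProductSpace ℝ H] {x : V → H} (hx : ∀ u, ‖x u‖ = 1)
    (htri : ∀ u v w : V, ‖x u - x w‖ ^ 2 ≤ ‖x u - x v‖ ^ 2 + ‖x v - x w‖ ^ 2)
    {β : ℝ} (hβ : 0 < β) :
    ∃ (N : ℕ) (y : V → Fin N → ℝ), (∀ u, ∑ i, y u i ^ 2 = 1) ∧
      (∀ u v w, distSq y u w ≤ distSq y u v + distSq y v w) ∧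
      (∀ u v, β ≤ ‖x u - x v‖ ^ 2 → 1 ≤ distSq y u v) ∧
      ∀ u v, distSq y u v ≤ 2 * β⁻¹ * ‖x u - x v‖ ^ 2 := by
  obtain ⟨N, y, hy⟩ := exists_exp_inner_vectors x hx (inv_nonneg.2 hβ.le)
  have h1 (u : V) : ∑ i, y u i ^ 2 = 1 := by
    simpa [sq] using hy u u
  have hd (u v : V) : distSq y u v = 2 - 2 * Real.exp (-(β⁻¹ * ‖x u - x v‖ ^ 2)) := by
    rw [← hy u v, distSq]
    simp only [sub_sq, Finset.sum_add_distrib, Finset.sum_sub_distrib, h1, mul_assoc,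
      ← Finset.mul_sum]
    ring
  refine ⟨N, y, h1, fun u v w => ?_, fun u v h => ?_, fun u v => ?_⟩
  · rw [hd, hd, hd]
    have ha : Real.exp (-(β⁻¹ * ‖x u - x v‖ ^ 2)) ≤ 1 := Real.exp_le_one_iff.2 (by
      rw [neg_nonpos]; positivity)
    have hb : Real.exp (-(β⁻¹ * ‖x v - x w‖ ^ 2)) ≤ 1 := Real.exp_le_one_iff.2 (by
      rw [neg_nonpos]; positivity)
    have hc : Real.exp (-(β⁻¹ * ‖x u - x v‖ ^ 2)) * Real.exp (-(β⁻¹ * ‖x v - x w‖ ^ 2)) ≤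
        Real.exp (-(β⁻¹ * ‖x u - x w‖ ^ 2)) := by
      rw [← Real.exp_add, Real.exp_le_exp]
      have := mul_le_mul_of_nonneg_left (htri u v w) (inv_nonneg.2 hβ.le)
      linarith
    nlinarith [mul_nonneg (sub_nonneg.2 ha) (sub_nonneg.2 hb)]
  · rw [hd]
    have h2 : (1 : ℝ) ≤ β⁻¹ * ‖x u - x v‖ ^ 2 := by
      rwa [inv_mul_eq_div, one_le_div hβ]
    have h3 : Real.exp (-(β⁻¹ * ‖x u - x v‖ ^ 2)) ≤ Real.exp (-1) := by
      rw [Real.exp_le_exp]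
      linarith
    linarith [Real.exp_neg_one_lt_d9]
  · rw [hd]
    linarith [Real.add_one_le_exp (-(β⁻¹ * ‖x u - x v‖ ^ 2))]

theorem stmt_2 : ∃ p C : ℝ, 0 < p ∧ p < 1 / 4 ∧ 0 < C ∧
    ∀ (V : Type) [Fintype V] [DecidableEq V]
      (H : Type) [NormedAddCommGroup H] [InnerProductSpace ℝ H]
      (x : V → H) (β : ℝ),
      2 ≤ Fintype.card V → (∀ u, ‖x u‖ = 1) →
      (∀ u v w : V, ‖x u - x w‖ ^ 2 ≤ ‖x u - x v‖ ^ 2 + ‖x v - x w‖ ^ 2) →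
      0 < β → β < 1 →
      ∃ ν : (V → Bool) → ℝ, IsProbDist ν ∧
        (∀ u v : V, β ≤ ‖x u - x v‖ ^ 2 → 2 * p ≤ Pr ν (fun ω => ω u ≠ ω v)) ∧
        (∀ e : Finset V, 2 ≤ e.card →
          Pr ν (fun ω => ∃ u ∈ e, ∃ v ∈ e, ω u ≠ ω v) ≤
            C * β⁻¹ * Real.sqrt (Real.logb 2 (Fintype.card V)) * maxDistSq x e) := by
  obtain ⟨p, κ, hp, hp2, hκ, hsep⟩ := exists_separating_set
  refine ⟨p / 2, 4 / κ, by positivity, by linarith, by positivity, ?_⟩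
  intro V _ _ H _ _ x β hV hx htri hβ _
  obtain ⟨N, y, hy1, hytri, hyfar, hyle⟩ := exists_rescaled_vectors hx htri hβ
  set T : ℕ := ⌊√(Real.log (Fintype.card V))⌋₊ + 1 with hT
  have hT0 : (0 : ℝ) < T := by rw [hT]; positivity
  obtain ⟨q, hq0, hq1, hq⟩ := exists_mixed_strategy
    (P := {r : V × V // 1 ≤ distSq y r.1 r.2}) (Z := Finset V)
    (fun r Z => if r.1.1 ∈ Z ∧ ∀ z ∈ Z, κ / T < distSq y z r.1.2 then 1 else 0) p
    fun w hw hw1 => by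
      convert hsep y (fun r => r.1.1) (fun r => r.1.2) w hV hy1 hytri (fun r => r.2) hw hw1
  choose ρ hρ hρsep hρcut using
    exists_random_thresholdCut (distSq_self y) hytri (div_pos hκ hT0)
  obtain ⟨ν, hν, hPr⟩ := exists_mixture hq0 hq1 hρ
  refine ⟨ν, hν, fun u v huv => ?_, fun e he => ?_⟩
  · rw [hPr, mul_div_cancel₀ _ two_ne_zero]
    refine (hq ⟨(u, v), hyfar u v huv⟩).trans (Finset.sum_le_sum fun Z _ => ?_)
    refine mul_le_mul_of_nonneg_left ?_ (hq0 Z)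
    split_ifs with h
    · exact (hρsep Z u v h.1 h.2).ge
    · exact Pr_nonneg (hρ Z) _
  · have hene : e.Nonempty := Finset.card_pos.1 (by omega)
    have hm : 0 ≤ maxDistSq x e := by
      obtain ⟨u, hu⟩ := hene
      exact (sq_nonneg _).trans (le_maxDistSq x hu hu)
    have hcut (Z : Finset V) : Pr (ρ Z) (fun ω => ∃ u ∈ e, ∃ v ∈ e, ω u ≠ ω v) ≤
        2 * β⁻¹ * maxDistSq x e / (κ / T) :=
      hρcut Z e _ hene fun u hu v hv => (hyle u v).trans
        (mul_le_mul_of_nonneg_left (le_maxDistSq x hu hv) (by positivity))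
    rw [hPr]
    calc ∑ Z, q Z * Pr (ρ Z) (fun ω => ∃ u ∈ e, ∃ v ∈ e, ω u ≠ ω v)
        ≤ ∑ Z, q Z * (2 * β⁻¹ * maxDistSq x e / (κ / T)) :=
          Finset.sum_le_sum fun Z _ => mul_le_mul_of_nonneg_left (hcut Z) (hq0 Z)
      _ = 2 / κ * β⁻¹ * maxDistSq x e * T := by
          rw [← Finset.sum_mul, hq1]
          field_simp
      _ ≤ 2 / κ * β⁻¹ * maxDistSq x e * (2 * √(Real.logb 2 (Fintype.card V))) :=
          mul_le_mul_of_nonneg_left (floor_sqrt_log_add_one_le hV) (by positivity)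
      _ = 4 / κ * β⁻¹ * √(Real.logb 2 (Fintype.card V)) * maxDistSq x e := by ring

end
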